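/- Let {X_n, n≥1} be a φ-mixing sequence of random variables with Σ_{n=1}^∞ φ^{1/2}(n) < ∞. Fix p ∈ (0,1) and assume the common marginal distribution function F possesses a positive continuous density f in a neighborhood N_p of ξ_p such that 0 < sup{f(x) : x ∈ N_p} < ∞, and that f′(x) is bounded in some neighborhood of ξ_p. Then with probability 1, |F_n(ξ_{p,n}) − F(ξ_p)| = O((log n)^{1/2} / n^{1/2}) as n → ∞. -/

import Mathlib

open MeasureTheory Filter Set

/-- The σ-algebra generated by the random variables `X i` for `i ∈ S`. -/
noncomputable def sigmaGen {Ω : Type*} (X : ℕ → Ω → ℝ) (S : Set ℕ) : MeasurableSpace Ω :=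
  ⨆ i ∈ S, MeasurableSpace.comap (X i) inferInstance

/-- The φ-mixing coefficients of the sequence `X` with respect to the measure `μ`:
`φ(n) = sup_{k ≥ 1} sup { |P(B|A) - P(B)| : A ∈ σ(X_i, 1 ≤ i ≤ k), P(A) > 0,
B ∈ σ(X_i, i ≥ k + n) }`. -/
noncomputable def phiCoef {Ω : Type*} [MeasurableSpace Ω] (X : ℕ → Ω → ℝ)
    (μ : Measure Ω) (n : ℕ) : ℝ :=
  sSup {r : ℝ | ∃ k : ℕ, 1 ≤ k ∧ ∃ A B : Set Ω,
    MeasurableSet[sigmaGen X {i | 1 ≤ i ∧ i ≤ k}] A ∧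
    MeasurableSet[sigmaGen X {i | k + n ≤ i}] B ∧
    0 < μ A ∧
    r = |(μ (A ∩ B)).toReal / (μ A).toReal - (μ B).toReal|}

/-- The empirical distribution function `F_n(x) = n⁻¹ ∑_{i=1}^n I(X_i ≤ x)`. -/
noncomputable def empDF {Ω : Type*} (X : ℕ → Ω → ℝ) (n : ℕ) (ω : Ω) (x : ℝ) : ℝ :=
  (n : ℝ)⁻¹ * ∑ i ∈ Finset.Icc 1 n, (if X i ω ≤ x then (1 : ℝ) else 0)

/-- The `p`-th quantile `F⁻¹(p) = inf {x : F(x) ≥ p}` of a distribution function `F`. -/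
noncomputable def quantile (F : ℝ → ℝ) (p : ℝ) : ℝ :=
  sInf {x : ℝ | p ≤ F x}

/-- The sample `p`-th quantile `ξ_{p,n} = F_n⁻¹(p) = inf {x : F_n(x) ≥ p}`. -/
noncomputable def sampleQuantile {Ω : Type*} (X : ℕ → Ω → ℝ) (n : ℕ) (ω : Ω) (p : ℝ) : ℝ :=
  sInf {x : ℝ | p ≤ empDF X n ω x}

theorem exp_mul_le_cosh_add_sinh {C y : ℝ} (hC : 0 < C) (hy : |y| ≤ C) (t : ℝ) :
    Real.exp (t * y) ≤ Real.cosh (t * C) + Real.sinh (t * C) / C * y := by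
  obtain ⟨h1, h2⟩ := abs_le.1 hy
  have ha : 0 ≤ (C + y) / (2 * C) := div_nonneg (by linarith) (by linarith)
  have hb : 0 ≤ (C - y) / (2 * C) := div_nonneg (by linarith) (by linarith)
  have hab : (C + y) / (2 * C) + (C - y) / (2 * C) = 1 := by
    field_simp
    ring
  have h := convexOn_exp.2 (mem_univ (t * C)) (mem_univ (-(t * C))) ha hb hab
  simp only [smul_eq_mul] at h
  have h3 : (C + y) / (2 * C) * (t * C) + (C - y) / (2 * C) * -(t * C) = t * y := by
    field_simp
    ring
  rw [h3] at h
  refine h.trans_eq ?_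
  rw [Real.cosh_eq, Real.sinh_eq]
  field_simp
  ring

section Azuma

variable {Ω : Type*} [m0 : MeasurableSpace Ω] {μ : Measure Ω}
  {ℱ : Filtration ℕ m0} {M : ℕ → Ω → ℝ} {C : ℝ}

theorem ae_abs_sub_zero_le_of_increment_le
    (hinc : ∀ i, ∀ᵐ ω ∂μ, |M (i + 1) ω - M i ω| ≤ C) (n : ℕ) :
    ∀ᵐ ω ∂μ, |M n ω - M 0 ω| ≤ n * C := by
  induction n with
  | zero => simp
  | succ n ih =>
    filter_upwards [ih, hinc n] with ω h1 h2
    push_cast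
    have := abs_sub_le (M (n + 1) ω) (M n ω) (M 0 ω)
    linarith

theorem ae_exp_mul_sub_zero_le (hinc : ∀ i, ∀ᵐ ω ∂μ, |M (i + 1) ω - M i ω| ≤ C)
    (t : ℝ) (n : ℕ) :
    ∀ᵐ ω ∂μ, ‖Real.exp (t * (M n ω - M 0 ω))‖ ≤ Real.exp (|t| * (n * C)) := by
  filter_upwards [ae_abs_sub_zero_le_of_increment_le hinc n] with ω h
  rw [Real.norm_eq_abs, Real.abs_exp, Real.exp_le_exp]
  calc t * (M n ω - M 0 ω) ≤ |t * (M n ω - M 0 ω)| := le_abs_self _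
    _ = |t| * |M n ω - M 0 ω| := abs_mul _ _
    _ ≤ _ := by gcongr

theorem stronglyMeasurable_exp_mul_sub_zero (hM : Martingale M ℱ μ) (t : ℝ) (n : ℕ) :
    StronglyMeasurable[ℱ n] fun ω => Real.exp (t * (M n ω - M 0 ω)) :=
  Real.continuous_exp.comp_stronglyMeasurable
    (((hM.1 n).sub ((hM.1 0).mono (ℱ.mono n.zero_le))).const_mul t)

theorem integrable_exp_mul_sub_zero [IsProbabilityMeasure μ]
    (hM : Martingale M ℱ μ)
    (hinc : ∀ i, ∀ᵐ ω ∂μ, |M (i + 1) ω - M i ω| ≤ C) (t : ℝ) (n : ℕ) :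
    Integrable (fun ω => Real.exp (t * (M n ω - M 0 ω))) μ :=
  Integrable.of_bound
    ((stronglyMeasurable_exp_mul_sub_zero hM t n).mono (ℱ.le n)).aestronglyMeasurable _
    (ae_exp_mul_sub_zero_le hinc t n)

theorem integral_exp_mul_martingale_le [IsProbabilityMeasure μ]
    (hM : Martingale M ℱ μ) (hC : 0 < C)
    (hinc : ∀ i, ∀ᵐ ω ∂μ, |M (i + 1) ω - M i ω| ≤ C) (t : ℝ) (n : ℕ) :
    ∫ ω, Real.exp (t * (M n ω - M 0 ω)) ∂μ ≤ Real.exp (n * ((t * C) ^ 2 / 2)) := by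
  induction n with
  | zero => simp
  | succ n ih =>
    set W : Ω → ℝ := fun ω => Real.exp (t * (M n ω - M 0 ω)) with hW
    set D : Ω → ℝ := M (n + 1) - M n with hD
    have hWm : StronglyMeasurable[ℱ n] W := stronglyMeasurable_exp_mul_sub_zero hM t n
    have hWi : Integrable W μ := integrable_exp_mul_sub_zero hM hinc t n
    have hDi : Integrable D μ := (hM.integrable _).sub (hM.integrable _)
    have hWDi : Integrable (fun ω => W ω * D ω) μ :=
      hDi.bdd_mul (hWm.mono (ℱ.le n)).aestronglyMeasurable (ae_exp_mul_sub_zero_le hinc t n)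
    have hD0 : μ[D | ℱ n] =ᵐ[μ] 0 := by
      filter_upwards [condExp_sub (hM.integrable (n + 1)) (hM.integrable n) (ℱ n),
        hM.2 n (n + 1) n.le_succ, hM.2 n n le_rfl] with ω h1 h2 h3
      rw [hD, h1, Pi.sub_apply, h2, h3, sub_self, Pi.zero_apply]
    have hWD0 : ∫ ω, W ω * D ω ∂μ = 0 := by
      have h := condExp_mul_of_stronglyMeasurable_left hWm hWDi hDi
      change ∫ ω, (W * D) ω ∂μ = 0
      rw [← integral_condExp (ℱ.le n)]
      refine integral_eq_zero_of_ae ?_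
      filter_upwards [h, hD0] with ω h1 h2
      rw [h1, Pi.mul_apply, h2, Pi.zero_apply, mul_zero]
    have hle : ∀ᵐ ω ∂μ, Real.exp (t * (M (n + 1) ω - M 0 ω)) ≤
        Real.cosh (t * C) * W ω + Real.sinh (t * C) / C * (W ω * D ω) := by
      filter_upwards [hinc n] with ω h
      have h1 : Real.exp (t * (M (n + 1) ω - M 0 ω)) =
          W ω * Real.exp (t * (M (n + 1) ω - M n ω)) := by
        rw [hW, ← Real.exp_add]
        congr 1
        ring
      have h2 := mul_le_mul_of_nonneg_left (exp_mul_le_cosh_add_sinh hC h t)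
        (Real.exp_pos (t * (M n ω - M 0 ω))).le
      rw [h1]
      refine h2.trans_eq ?_
      simp only [hW, hD, Pi.sub_apply]
      ring
    calc ∫ ω, Real.exp (t * (M (n + 1) ω - M 0 ω)) ∂μ
        ≤ ∫ ω, (Real.cosh (t * C) * W ω + Real.sinh (t * C) / C * (W ω * D ω)) ∂μ :=
          integral_mono_ae (integrable_exp_mul_sub_zero hM hinc t (n + 1))
            ((hWi.const_mul _).add (hWDi.const_mul _)) hle
      _ = Real.cosh (t * C) * ∫ ω, W ω ∂μ := by
          rw [integral_add (hWi.const_mul _) (hWDi.const_mul (Real.sinh (t * C) / C)),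
            integral_const_mul, integral_const_mul, hWD0, mul_zero, add_zero]
      _ ≤ Real.exp ((t * C) ^ 2 / 2) * Real.exp (n * ((t * C) ^ 2 / 2)) :=
          mul_le_mul (Real.cosh_le_exp_half_sq _) ih
            (integral_nonneg fun ω => (Real.exp_pos _).le) (Real.exp_pos _).le
      _ = Real.exp ((n + 1 : ℕ) * ((t * C) ^ 2 / 2)) := by
          rw [← Real.exp_add]
          congr 1
          push_cast
          ring

/-- One-sided **Azuma–Hoeffding inequality**. -/
theorem measureReal_martingale_ge_le [IsProbabilityMeasure μ]
    (hM : Martingale M ℱ μ) (hC : 0 < C)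
    (hinc : ∀ i, ∀ᵐ ω ∂μ, |M (i + 1) ω - M i ω| ≤ C) {n : ℕ} (hn : 0 < n)
    {r : ℝ} (hr : 0 ≤ r) :
    μ.real {ω | r ≤ M n ω - M 0 ω} ≤ Real.exp (-(r ^ 2 / (2 * n * C ^ 2))) := by
  have hn' : (0 : ℝ) < n := Nat.cast_pos.2 hn
  set t : ℝ := r / (n * C ^ 2) with ht
  have h := ProbabilityTheory.measure_ge_le_exp_mul_mgf (μ := μ)
    (X := fun ω => M n ω - M 0 ω) (t := t) r (by positivity)
    (integrable_exp_mul_sub_zero hM hinc t n)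
  refine h.trans ?_
  calc Real.exp (-t * r) * ProbabilityTheory.mgf (fun ω => M n ω - M 0 ω) μ t
      ≤ Real.exp (-t * r) * Real.exp (n * ((t * C) ^ 2 / 2)) := by
        gcongr
        exact integral_exp_mul_martingale_le hM hC hinc t n
    _ = _ := by
        rw [← Real.exp_add, ht]
        congr 1
        field_simp
        ring

/-- Two-sided **Azuma–Hoeffding inequality**. -/
theorem measureReal_abs_martingale_ge_le [IsProbabilityMeasure μ]
    (hM : Martingale M ℱ μ) (hC : 0 < C)
    (hinc : ∀ i, ∀ᵐ ω ∂μ, |M (i + 1) ω - M i ω| ≤ C) {n : ℕ} (hn : 0 < n)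
    {r : ℝ} (hr : 0 ≤ r) :
    μ.real {ω | r ≤ |M n ω - M 0 ω|} ≤ 2 * Real.exp (-(r ^ 2 / (2 * n * C ^ 2))) := by
  have hneg : ∀ i, ∀ᵐ ω ∂μ, |(-M) (i + 1) ω - (-M) i ω| ≤ C := fun i => by
    filter_upwards [hinc i] with ω h
    rw [abs_sub_comm] at h
    convert h using 2
    simp only [Pi.neg_apply]
    ring
  have hsub : {ω | r ≤ |M n ω - M 0 ω|} ⊆
      {ω | r ≤ M n ω - M 0 ω} ∪ {ω | r ≤ (-M) n ω - (-M) 0 ω} := fun ω hω => by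
    rcases le_abs.1 (show r ≤ |M n ω - M 0 ω| from hω) with h | h
    · exact Or.inl h
    · refine Or.inr (h.trans_eq ?_)
      simp only [Pi.neg_apply]
      ring
  calc μ.real {ω | r ≤ |M n ω - M 0 ω|}
      ≤ μ.real ({ω | r ≤ M n ω - M 0 ω} ∪ {ω | r ≤ (-M) n ω - (-M) 0 ω}) :=
        measureReal_mono hsub
    _ ≤ _ := measureReal_union_le _ _
    _ ≤ _ := by
        have h1 := measureReal_martingale_ge_le hM hC hinc hn hr
        have h2 := measureReal_martingale_ge_le hM.neg hC hneg hn hr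
        linarith

end Azuma

section Concentration

variable {Ω : Type*} [m0 : MeasurableSpace Ω] {μ : Measure Ω} [IsProbabilityMeasure μ]

theorem ae_abs_condExp_indicator_sub_le {m : MeasurableSpace Ω} (hm : m ≤ m0) {B : Set Ω}
    (hB : MeasurableSet[m0] B) {q ε : ℝ}
    (h : ∀ A, MeasurableSet[m] A → |μ.real (A ∩ B) - q * μ.real A| ≤ ε * μ.real A) :
    ∀ᵐ ω ∂μ, |(μ[B.indicator (fun _ => (1 : ℝ)) | m]) ω - q| ≤ ε := by
  set f : Ω → ℝ := B.indicator (fun _ => (1 : ℝ)) with hf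
  have hfi : Integrable f μ := (integrable_const 1).indicator hB
  have hcondint : ∀ A, MeasurableSet[m] A →
      ∫ ω in A, (μ[f | m]) ω ∂μ.trim hm = μ.real (A ∩ B) := by
    intro A hA
    rw [← setIntegral_trim hm stronglyMeasurable_condExp hA, setIntegral_condExp hm hfi hA, hf,
      setIntegral_indicator hB, setIntegral_const, smul_eq_mul, mul_one]
  have hconst : ∀ A, MeasurableSet[m] A → ∀ c : ℝ,
      ∫ _ in A, c ∂μ.trim hm = c * μ.real A := by
    intro A hA c
    rw [setIntegral_const, smul_eq_mul, mul_comm, measureReal_def, trim_measurableSet_eq hm hA,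
      measureReal_def]
  have hci : Integrable (μ[f | m]) (μ.trim hm) :=
    integrable_condExp.trim hm stronglyMeasurable_condExp
  have hle : ∀ᵐ ω ∂μ, (μ[f | m]) ω ≤ q + ε := by
    refine ae_le_of_ae_le_trim (hm := hm)
      (ae_le_of_forall_setIntegral_le hci (integrable_const (q + ε)) fun A hA _ => ?_)
    rw [hcondint A hA, hconst A hA]
    have := (abs_le.1 (h A hA)).2
    linarith
  have hge : ∀ᵐ ω ∂μ, q - ε ≤ (μ[f | m]) ω := by
    refine ae_le_of_ae_le_trim (hm := hm)
      (ae_le_of_forall_setIntegral_le (integrable_const (q - ε)) hci fun A hA _ => ?_)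
    rw [hcondint A hA, hconst A hA]
    have := (abs_le.1 (h A hA)).1
    linarith
  filter_upwards [hle, hge] with ω h1 h2
  exact abs_le.2 ⟨by linarith, by linarith⟩

/-- Concentration of partial sums of a bounded sequence whose conditional expectations given the
past return to the common mean `q` at a summable rate `g`. -/
theorem measureReal_abs_sum_sub_ge_le {ℱ : Filtration ℕ m0} (hℱ : ℱ 0 = ⊥) {Y : ℕ → Ω → ℝ}
    (hYm : ∀ j, StronglyMeasurable[ℱ (j + 1)] (Y j)) (hYi : ∀ j, Integrable (Y j) μ)
    {q : ℝ} (hYq : ∀ j, ∫ ω, Y j ω ∂μ = q) {g : ℕ → ℝ} (hg0 : 0 < g 0) (hgnn : ∀ k, 0 ≤ g k)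
    (hg : Summable g) (hY0 : ∀ j ω, |Y j ω - q| ≤ g 0)
    (hY : ∀ i k, ∀ᵐ ω ∂μ, |(μ[Y (i + k) | ℱ i]) ω - q| ≤ g (k + 1))
    {n : ℕ} (hn : 0 < n) {r : ℝ} (hr : 0 ≤ r) :
    μ.real {ω | r ≤ |∑ j ∈ Finset.range n, Y j ω - n * q|} ≤
      2 * Real.exp (-(r ^ 2 / (2 * n * (2 * ∑' k, g k) ^ 2))) := by
  set S : Ω → ℝ := ∑ j ∈ Finset.range n, Y j with hS
  set M : ℕ → Ω → ℝ := fun i => μ[S | ℱ i] with hM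
  have hpast : ∀ i j, j < i → μ[Y j | ℱ i] = Y j := fun i j hij =>
    condExp_of_stronglyMeasurable (ℱ.le i) ((hYm j).mono (ℱ.mono hij)) (hYi j)
  have hnear : ∀ i k, ∀ᵐ ω ∂μ, |(μ[Y (i + k) | ℱ (i + 1)]) ω - q| ≤ g k := by
    intro i k
    rcases k with _ | k
    · rw [add_zero, hpast (i + 1) i i.lt_succ_self]
      exact ae_of_all _ (hY0 i)
    · rw [show i + (k + 1) = (i + 1) + k by ring]
      exact hY (i + 1) k
  have hterm : ∀ i k, ∀ᵐ ω ∂μ,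
      |(μ[Y (i + k) | ℱ (i + 1)]) ω - (μ[Y (i + k) | ℱ i]) ω| ≤ g k + g (k + 1) := by
    intro i k
    filter_upwards [hnear i k, hY i k] with ω h1 h2
    rw [abs_sub_comm] at h2
    exact (abs_sub_le _ q _).trans (add_le_add h1 h2)
  have hMsum : ∀ i, M i =ᵐ[μ] ∑ j ∈ Finset.range n, μ[Y j | ℱ i] := fun i =>
    condExp_finsetSum (fun j _ => hYi j) _
  have hgsum : ∀ N, ∑ k ∈ Finset.range N, (g k + g (k + 1)) ≤ 2 * ∑' k, g k := by
    intro N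
    rw [Finset.sum_add_distrib, two_mul]
    refine add_le_add (hg.sum_le_tsum _ fun k _ => hgnn k) ?_
    refine le_trans ?_ (hg.sum_le_tsum (Finset.range (N + 1)) fun k _ => hgnn k)
    rw [Finset.sum_range_succ']
    exact le_add_of_nonneg_right (hgnn 0)
  have hinc : ∀ i, ∀ᵐ ω ∂μ, |M (i + 1) ω - M i ω| ≤ 2 * ∑' k, g k := by
    intro i
    filter_upwards [hMsum i, hMsum (i + 1), ae_all_iff.2 (hterm i)] with ω h1 h2 h3
    rw [h1, h2, Finset.sum_apply, Finset.sum_apply, ← Finset.sum_sub_distrib]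
    refine (Finset.abs_sum_le_sum_abs _ _).trans ?_
    calc ∑ j ∈ Finset.range n, |(μ[Y j | ℱ (i + 1)]) ω - (μ[Y j | ℱ i]) ω|
        ≤ ∑ j ∈ Finset.range (i + n), |(μ[Y j | ℱ (i + 1)]) ω - (μ[Y j | ℱ i]) ω| :=
          Finset.sum_le_sum_of_subset_of_nonneg
            (Finset.range_mono (Nat.le_add_left n i)) fun _ _ _ => abs_nonneg _
      _ = ∑ k ∈ Finset.range n, |(μ[Y (i + k) | ℱ (i + 1)]) ω - (μ[Y (i + k) | ℱ i]) ω| := by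
          rw [Finset.sum_range_add, Finset.sum_eq_zero, zero_add]
          intro j hj
          have hj' := Finset.mem_range.1 hj
          rw [hpast i j hj', hpast (i + 1) j (hj'.trans i.lt_succ_self), sub_self, abs_zero]
      _ ≤ ∑ k ∈ Finset.range n, (g k + g (k + 1)) := Finset.sum_le_sum fun k _ => h3 k
      _ ≤ _ := hgsum n
  have hC : 0 < 2 * ∑' k, g k :=
    mul_pos two_pos (hg.tsum_pos hgnn 0 hg0)
  have hM0 : M 0 = fun _ => n * q := by
    have hℱ' : ℱ.seq 0 = ⊥ := hℱ
    simp only [hM]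
    rw [hℱ', condExp_bot, hS]
    simp only [Finset.sum_apply]
    rw [integral_finsetSum _ fun j _ => hYi j]
    simp [hYq]
  have hMn : M n = S := by
    refine condExp_of_stronglyMeasurable (ℱ.le n) ?_ (integrable_finsetSum' _ fun j _ => hYi j)
    exact Finset.stronglyMeasurable_sum _ fun j hj =>
      (hYm j).mono (ℱ.mono (Finset.mem_range.1 hj))
  have h := measureReal_abs_martingale_ge_le (martingale_condExp S ℱ μ) hC hinc hn hr
  change μ.real {ω | r ≤ |M n ω - M 0 ω|} ≤ _ at h
  simpa only [hM0, hMn, hS, Finset.sum_apply] using h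

end Concentration

section Mixing

theorem sigmaGen_mono {Ω : Type*} {X : ℕ → Ω → ℝ} {S T : Set ℕ} (h : S ⊆ T) :
    sigmaGen X S ≤ sigmaGen X T :=
  iSup₂_le fun i hi => le_iSup₂_of_le i (h hi) le_rfl

theorem measurable_sigmaGen {Ω : Type*} {X : ℕ → Ω → ℝ} {S : Set ℕ} {i : ℕ}
    (hi : i ∈ S) :
    Measurable[sigmaGen X S] (X i) :=
  Measurable.of_comap_le (le_iSup₂_of_le i hi le_rfl)

variable {Ω : Type*} [m0 : MeasurableSpace Ω] {μ : Measure Ω} {X : ℕ → Ω → ℝ}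

theorem sigmaGen_le (hX : ∀ i, Measurable (X i)) (S : Set ℕ) : sigmaGen X S ≤ m0 :=
  iSup₂_le fun i _ => (hX i).comap_le

/-- The filtration of σ-algebras generated by `X 1, …, X k`. -/
noncomputable def pastFiltration (hX : ∀ i, Measurable (X i)) : Filtration ℕ m0 where
  seq k := sigmaGen X {i | 1 ≤ i ∧ i ≤ k}
  mono' _ _ h := sigmaGen_mono fun _ hi => ⟨hi.1, hi.2.trans h⟩
  le' _ := sigmaGen_le hX _

theorem pastFiltration_zero (hX : ∀ i, Measurable (X i)) : pastFiltration hX 0 = ⊥ := by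
  refine le_bot_iff.1 (iSup₂_le fun i hi => ?_)
  have h1 : 1 ≤ i := hi.1
  have h2 : i ≤ 0 := hi.2
  omega

theorem phiCoef_nonneg (n : ℕ) : 0 ≤ phiCoef X μ n := by
  refine Real.sSup_nonneg ?_
  rintro r ⟨k, -, A, B, -, -, -, rfl⟩
  exact abs_nonneg _

variable [IsProbabilityMeasure μ]

theorem abs_cond_sub_le_one (A B : Set Ω) :
    |(μ (A ∩ B)).toReal / (μ A).toReal - (μ B).toReal| ≤ 1 := by
  have h1 : (μ (A ∩ B)).toReal / (μ A).toReal ≤ 1 :=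
    div_le_one_of_le₀ (measureReal_mono inter_subset_left) ENNReal.toReal_nonneg
  have h2 : (μ B).toReal ≤ 1 := measureReal_le_one
  have h3 : 0 ≤ (μ (A ∩ B)).toReal / (μ A).toReal := by positivity
  have h4 : 0 ≤ (μ B).toReal := ENNReal.toReal_nonneg
  exact abs_le.2 ⟨by linarith, by linarith⟩

theorem phiCoef_le_one (n : ℕ) : phiCoef X μ n ≤ 1 := by
  refine Real.sSup_le ?_ zero_le_one
  rintro r ⟨k, -, A, B, -, -, -, rfl⟩
  exact abs_cond_sub_le_one A B

theorem abs_measureReal_inter_sub_le_phiCoef {k n : ℕ} {A B : Set Ω}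
    (hA : MeasurableSet[sigmaGen X {i | 1 ≤ i ∧ i ≤ k}] A)
    (hB : MeasurableSet[sigmaGen X {i | k + n ≤ i}] B) :
    |μ.real (A ∩ B) - μ.real B * μ.real A| ≤ phiCoef X μ n * μ.real A := by
  rcases Nat.eq_zero_or_pos k with rfl | hk
  · have hbot : sigmaGen X {i | 1 ≤ i ∧ i ≤ 0} ≤ ⊥ := by
      refine iSup₂_le fun i hi => ?_
      have h1 : 1 ≤ i := hi.1
      have h2 : i ≤ 0 := hi.2
      omega
    rcases MeasurableSpace.measurableSet_bot_iff.1 (hbot _ hA) with rfl | rfl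
    · simp
    · simpa using phiCoef_nonneg n
  rcases eq_or_ne (μ A) 0 with hA0 | hA0
  · have h1 : μ.real A = 0 := by simp [measureReal_def, hA0]
    have h2 : μ.real (A ∩ B) = 0 :=
      le_antisymm (h1 ▸ measureReal_mono inter_subset_left) measureReal_nonneg
    simp [h1, h2]
  · have hpos : 0 < μ.real A := ENNReal.toReal_pos hA0 (measure_ne_top _ _)
    have hle : |μ.real (A ∩ B) / μ.real A - μ.real B| ≤ phiCoef X μ n := by
      refine le_csSup ⟨1, ?_⟩ ⟨k, hk, A, B, hA, hB, pos_iff_ne_zero.2 hA0, rfl⟩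
      rintro r ⟨k, -, A, B, -, -, -, rfl⟩
      exact abs_cond_sub_le_one A B
    calc |μ.real (A ∩ B) - μ.real B * μ.real A|
        = |μ.real (A ∩ B) / μ.real A - μ.real B| * μ.real A := by
          rw [← abs_of_pos hpos, ← abs_mul, abs_of_pos hpos, sub_mul,
            div_mul_cancel₀ _ hpos.ne']
      _ ≤ _ := by gcongr

theorem summable_phiCoef (hsum : Summable fun n : ℕ => Real.sqrt (phiCoef X μ (n + 1))) :
    Summable fun n : ℕ => phiCoef X μ (n + 1) :=
  hsum.of_nonneg_of_le (fun _ => phiCoef_nonneg _) fun _ =>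
    Real.le_sqrt_self_iff.2 (phiCoef_le_one _)

end Mixing

section Quantile

theorem apply_quantile_eq {F : ℝ → ℝ} (hmono : Monotone F) (hbot : Tendsto F atBot (nhds 0))
    (htop : Tendsto F atTop (nhds 1)) {p : ℝ} (hp0 : 0 < p) (hp1 : p < 1)
    (hc : ContinuousAt F (quantile F p)) : F (quantile F p) = p := by
  have hne : {x : ℝ | p ≤ F x}.Nonempty := (htop.eventually_const_le hp1).exists
  have hbdd : BddBelow {x : ℝ | p ≤ F x} := by
    obtain ⟨a, ha⟩ := (hbot.eventually_lt_const hp0).exists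
    refine ⟨a, fun x hx => le_of_not_gt fun hxa => ?_⟩
    exact absurd ((hmono hxa.le).trans_lt ha) (not_lt.2 hx)
  apply le_antisymm
  · refine le_of_tendsto_of_frequently hc ((frequently_lt_nhds _).mono fun x hx => ?_)
    exact (not_le.1 fun h => absurd (csInf_le hbdd h) (not_le.2 hx)).le
  · exact ge_of_tendsto_of_frequently hc
      (mem_closure_iff_frequently.1 (csInf_mem_closure hne hbdd))

variable {Ω : Type*} {X : ℕ → Ω → ℝ} {ω : Ω} {n : ℕ}

theorem empDF_mono : Monotone (empDF X n ω) := by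
  intro x y hxy
  unfold empDF
  gcongr with i
  split_ifs with h1 h2
  · exact le_rfl
  · exact absurd (h1.trans hxy) h2
  · exact zero_le_one
  · exact le_rfl

theorem eventually_empDF_eq_zero : ∀ᶠ x in atBot, empDF X n ω x = 0 := by
  have h : ∀ᶠ x in atBot, ∀ i ∈ Finset.Icc 1 n, x < X i ω :=
    (Filter.eventually_all_finset _).2 fun i _ => eventually_lt_atBot _
  filter_upwards [h] with x hx
  unfold empDF
  rw [Finset.sum_eq_zero fun i hi => if_neg (not_le.2 (hx i hi)), mul_zero]

theorem eventually_empDF_eq_one (hn : 0 < n) : ∀ᶠ x in atTop, empDF X n ω x = 1 := by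
  have h : ∀ᶠ x in atTop, ∀ i ∈ Finset.Icc 1 n, X i ω ≤ x :=
    (Filter.eventually_all_finset _).2 fun i _ => eventually_ge_atTop _
  filter_upwards [h] with x hx
  have hn' : (n : ℝ) ≠ 0 := Nat.cast_ne_zero.2 hn.ne'
  unfold empDF
  rw [Finset.sum_congr rfl fun i hi => if_pos (hx i hi)]
  simp [hn']

theorem isClosed_setOf_le_empDF (p : ℝ) : IsClosed {x | p ≤ empDF X n ω x} := by
  refine isClosed_of_closure_subset fun x hx => ?_
  have hlt : ∀ᶠ y in nhds x, ∀ i ∈ Finset.Icc 1 n, X i ω ≤ y → X i ω ≤ x := by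
    refine (Filter.eventually_all_finset _).2 fun i _ => ?_
    rcases le_or_gt (X i ω) x with h | h
    · exact Eventually.of_forall fun _ _ => h
    · filter_upwards [eventually_lt_nhds h] with y hy hy'
      exact absurd hy' (not_le.2 hy)
  obtain ⟨y, hy, hyx⟩ := ((mem_closure_iff_frequently.1 hx).and_eventually hlt).exists
  refine le_trans (show p ≤ empDF X n ω y from hy) ?_
  unfold empDF
  gcongr with i hi
  split_ifs with h1 h2
  · exact le_rfl
  · exact absurd (hyx i hi h1) h2
  · exact zero_le_one
  · exact le_rfl

theorem bddBelow_setOf_le_empDF {p : ℝ} (hp : 0 < p) :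
    BddBelow {x | p ≤ empDF X n ω x} := by
  obtain ⟨a, ha⟩ := (eventually_empDF_eq_zero (X := X) (n := n) (ω := ω)).exists
  refine ⟨a, fun x hx => le_of_not_gt fun hxa => ?_⟩
  have h1 : p ≤ empDF X n ω x := hx
  have h2 := empDF_mono (X := X) (n := n) (ω := ω) hxa.le
  linarith

theorem le_empDF_sampleQuantile (hn : 0 < n) {p : ℝ} (hp0 : 0 < p) (hp1 : p ≤ 1) :
    p ≤ empDF X n ω (sampleQuantile X n ω p) := by
  obtain ⟨b, hb⟩ := (eventually_empDF_eq_one (X := X) (ω := ω) hn).exists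
  exact (isClosed_setOf_le_empDF p).csInf_mem ⟨b, hp1.trans_eq hb.symm⟩
    (bddBelow_setOf_le_empDF hp0)

theorem sampleQuantile_le {p b : ℝ} (hp : 0 < p) (hb : p ≤ empDF X n ω b) :
    sampleQuantile X n ω p ≤ b :=
  csInf_le (bddBelow_setOf_le_empDF hp) hb

end Quantile

section Deviation

variable {Ω : Type*} [MeasurableSpace Ω] {μ : Measure Ω} [IsProbabilityMeasure μ]
  {X : ℕ → Ω → ℝ}

theorem exists_measureReal_abs_empDF_sub_ge_le (hX : ∀ i, Measurable (X i))
    (hsum : Summable fun n : ℕ => Real.sqrt (phiCoef X μ (n + 1)))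
    {F : ℝ → ℝ} (hF : ∀ i, 1 ≤ i → ∀ x, F x = (μ {ω | X i ω ≤ x}).toReal) :
    ∃ C : ℝ, 0 < C ∧ ∀ (n : ℕ) (x r : ℝ), 0 < n → 0 ≤ r →
      μ.real {ω | r ≤ |empDF X n ω x - F x|} ≤ 2 * Real.exp (-(n * r ^ 2 / (2 * C ^ 2))) := by
  set g : ℕ → ℝ := fun k => if k = 0 then 1 else phiCoef X μ k with hg
  have hgnn : ∀ k, 0 ≤ g k := fun k => by
    simp only [hg]
    split_ifs
    exacts [zero_le_one, phiCoef_nonneg k]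
  have hg0 : 0 < g 0 := by simp [hg]
  have hgs : Summable g := by
    rw [← summable_nat_add_iff 1]
    simpa [hg] using summable_phiCoef hsum
  refine ⟨2 * ∑' k, g k, mul_pos two_pos (hgs.tsum_pos hgnn 0 hg0), fun n x r hn hr => ?_⟩
  have hn' : (0 : ℝ) < n := Nat.cast_pos.2 hn
  set B : ℕ → Set Ω := fun j => {ω | X (j + 1) ω ≤ x} with hB
  have hBF : ∀ j, μ.real (B j) = F x := fun j => (hF (j + 1) (Nat.le_add_left 1 j) x).symm
  have hBm : ∀ j, MeasurableSet (B j) := fun j => hX (j + 1) measurableSet_Iic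
  set Y : ℕ → Ω → ℝ := fun j => (B j).indicator fun _ => 1 with hY
  have hsumY : ∀ ω, ∑ j ∈ Finset.range n, Y j ω - n * F x = n * (empDF X n ω x - F x) := by
    intro ω
    have : ∑ i ∈ Finset.Icc 1 n, (if X i ω ≤ x then (1 : ℝ) else 0) =
        ∑ j ∈ Finset.range n, Y j ω := by
      rw [← Finset.Ico_add_one_right_eq_Icc, Finset.sum_Ico_eq_sum_range]
      refine Finset.sum_congr (by simp) fun j _ => ?_
      simp [hY, hB, Set.indicator_apply, add_comm 1 j]
    rw [empDF, this]
    field_simp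
  have h := measureReal_abs_sum_sub_ge_le (μ := μ) (ℱ := pastFiltration hX)
    (pastFiltration_zero hX) (Y := Y) (q := F x) (g := g)
    (fun j => (stronglyMeasurable_const).indicator
      (measurable_sigmaGen (S := {i | 1 ≤ i ∧ i ≤ j + 1}) ⟨Nat.le_add_left 1 j, le_rfl⟩
        measurableSet_Iic))
    (fun j => (integrable_const 1).indicator (hBm j))
    (fun j => by rw [hY, integral_indicator_const _ (hBm j), hBF, smul_eq_mul, mul_one])
    hg0 hgnn hgs
    (fun j ω => by
      have h0 : 0 ≤ F x := hBF 0 ▸ measureReal_nonneg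
      have h1 : F x ≤ 1 := hBF 0 ▸ measureReal_le_one
      simp only [hY, hg, Set.indicator_apply, if_true]
      split_ifs <;> exact abs_le.2 ⟨by linarith, by linarith⟩)
    (fun i k => by
      refine ae_abs_condExp_indicator_sub_le ((pastFiltration hX).le i) (hBm (i + k))
        fun A hA => ?_
      rw [← hBF (i + k)]
      refine (abs_measureReal_inter_sub_le_phiCoef (n := k + 1) hA ?_).trans_eq (by simp [hg])
      exact measurable_sigmaGen (S := {j | i + (k + 1) ≤ j}) (i := i + k + 1)
        (add_assoc i k 1).ge measurableSet_Iic)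
    hn (r := n * r) (by positivity)
  convert h using 3
  · ext ω
    rw [hsumY, abs_mul, abs_of_pos hn']
    exact (mul_le_mul_iff_right₀ hn').symm
  · field_simp

theorem log_rpow_div_rpow_eq_sqrt (n : ℕ) :
    Real.log n ^ ((1 : ℝ) / 2) / (n : ℝ) ^ ((1 : ℝ) / 2) = Real.sqrt (Real.log n / n) := by
  rw [Real.sqrt_eq_rpow, Real.div_rpow (Real.log_natCast_nonneg n) n.cast_nonneg]

theorem tendsto_sqrt_log_div_atTop :
    Tendsto (fun n : ℕ => Real.sqrt (Real.log n / n)) atTop (nhds 0) := by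
  have h := (Real.tendsto_pow_log_div_mul_add_atTop 1 0 1 one_ne_zero).comp
    (tendsto_natCast_atTop_atTop (R := ℝ))
  have hsqrt := (Real.continuous_sqrt.tendsto 0).comp h
  simpa [Function.comp_def] using hsqrt

/-- Along any deterministic sequence of points, the empirical distribution function almost surely
deviates from `F` by at most a constant times `(log n / n)^{1/2}`. -/
theorem exists_ae_eventually_abs_empDF_sub_lt (hX : ∀ i, Measurable (X i))
    (hsum : Summable fun n : ℕ => Real.sqrt (phiCoef X μ (n + 1)))
    {F : ℝ → ℝ} (hF : ∀ i, 1 ≤ i → ∀ x, F x = (μ {ω | X i ω ≤ x}).toReal) :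
    ∃ C : ℝ, 0 < C ∧ ∀ b : ℕ → ℝ, ∀ᵐ ω ∂μ, ∀ᶠ n : ℕ in atTop,
      |empDF X n ω (b n) - F (b n)| < C * Real.sqrt (Real.log n / n) := by
  obtain ⟨C, hC, h⟩ := exists_measureReal_abs_empDF_sub_ge_le hX hsum hF
  refine ⟨2 * C, by positivity, fun b => ?_⟩
  set s : ℕ → Set Ω := fun n =>
    {ω | 2 * C * Real.sqrt (Real.log n / n) ≤ |empDF X n ω (b n) - F (b n)|} with hs
  have hbound : ∀ n : ℕ, 0 < n → μ.real (s n) ≤ 2 * (1 / (n : ℝ) ^ 2) := by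
    intro n hn
    have hn' : (0 : ℝ) < n := Nat.cast_pos.2 hn
    refine (h n (b n) _ hn (by positivity)).trans_eq ?_
    have hlog : 0 ≤ Real.log n / n := div_nonneg (Real.log_natCast_nonneg n) hn'.le
    rw [mul_pow, Real.sq_sqrt hlog,
      show (n : ℝ) * ((2 * C) ^ 2 * (Real.log n / n)) / (2 * C ^ 2) = Real.log ((n : ℝ) ^ 2) by
        rw [Real.log_pow]
        push_cast
        field_simp,
      Real.exp_neg, Real.exp_log (by positivity), one_div]
  have hsummable : Summable fun n => μ.real (s n) := by
    refine Summable.of_norm_bounded_eventually_nat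
      ((Real.summable_one_div_nat_pow.2 one_lt_two).mul_left 2) ?_
    filter_upwards [eventually_gt_atTop 0] with n hn
    rw [Real.norm_of_nonneg measureReal_nonneg]
    exact hbound n hn
  have hfin : ∑' n, μ (s n) ≠ ⊤ := by
    have := hsummable.tsum_ofReal_ne_top
    simpa using this
  filter_upwards [ae_eventually_notMem hfin] with ω hω
  filter_upwards [hω] with n hn
  exact not_le.1 hn

end Deviation

/-- For a φ-mixing sequence with `∑ φ^{1/2}(n) < ∞` and a marginal distribution
function `F` with positive continuous density `f` near `ξ_p` (with bounded `f'`
in some neighborhood of `ξ_p`), with probability 1,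
`|F_n(ξ_{p,n}) - F(ξ_p)| = O((log n)^{1/2} / n^{1/2})` as `n → ∞`. -/
theorem bahadur_empDF_at_sample_quantile {Ω : Type*} [MeasurableSpace Ω] (μ : Measure Ω)
    [IsProbabilityMeasure μ]
    (X : ℕ → Ω → ℝ) (hX : ∀ i, Measurable (X i))
    (hanti : Antitone (phiCoef X μ))
    (hmix : Tendsto (phiCoef X μ) atTop (nhds 0))
    (hsum : Summable fun n : ℕ => Real.sqrt (phiCoef X μ (n + 1)))
    (F : ℝ → ℝ) (hF : ∀ i, 1 ≤ i → ∀ x, F x = (μ {ω | X i ω ≤ x}).toReal)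
    (p : ℝ) (hp : 0 < p ∧ p < 1)
    (Np : Set ℝ) (hNp : Np ∈ nhds (quantile F p))
    (f : ℝ → ℝ) (hfc : ContinuousOn f Np) (hfpos : ∀ x ∈ Np, 0 < f x)
    (hFf : ∀ x ∈ Np, HasDerivAt F (f x) x)
    (d : ℝ) (hd : IsLUB (f '' Np) d) (hd0 : 0 < d)
    (Np' : Set ℝ) (hNp' : Np' ∈ nhds (quantile F p))
    (f' : ℝ → ℝ) (hff' : ∀ x ∈ Np', HasDerivAt f (f' x) x)
    (hf'bdd : ∃ M : ℝ, ∀ x ∈ Np', |f' x| ≤ M) :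
    ∀ᵐ ω ∂μ,
      (fun n : ℕ => |empDF X n ω (sampleQuantile X n ω p) - F (quantile F p)|)
        =O[atTop] fun n : ℕ => Real.log n ^ ((1 : ℝ) / 2) / (n : ℝ) ^ ((1 : ℝ) / 2) := by
  obtain ⟨hp0, hp1⟩ := hp
  set ξ := quantile F p with hξ
  have hderiv : HasDerivAt F (f ξ) ξ := hFf ξ (mem_of_mem_nhds hNp)
  have hfξ : 0 < f ξ := hfpos ξ (mem_of_mem_nhds hNp)
  have hFp : F ξ = p := by
    have : IsProbabilityMeasure (μ.map (X 1)) :=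
      Measure.isProbabilityMeasure_map (hX 1).aemeasurable
    have hcdf : F = ProbabilityTheory.cdf (μ.map (X 1)) := by
      ext x
      rw [hF 1 le_rfl x, ProbabilityTheory.cdf_eq_real, measureReal_def,
        Measure.map_apply (hX 1) measurableSet_Iic]
      rfl
    refine apply_quantile_eq ?_ ?_ ?_ hp0 hp1 hderiv.continuousAt
    · rw [hcdf]
      exact ProbabilityTheory.monotone_cdf _
    · rw [hcdf]
      exact ProbabilityTheory.tendsto_cdf_atBot _
    · rw [hcdf]
      exact ProbabilityTheory.tendsto_cdf_atTop _
  obtain ⟨C, hC, hdev⟩ := exists_ae_eventually_abs_empDF_sub_lt hX hsum hF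
  set ρ : ℕ → ℝ := fun n => Real.sqrt (Real.log n / n) with hρ
  set b : ℕ → ℝ := fun n => ξ + 2 * C / f ξ * ρ n with hb
  have hb_tendsto : Tendsto b atTop (nhds ξ) := by
    have h := (tendsto_sqrt_log_div_atTop.const_mul (2 * C / f ξ)).const_add ξ
    rwa [mul_zero, add_zero] at h
  have hbF : ∀ᶠ n in atTop, |F (b n) - p - 2 * C * ρ n| ≤ C * ρ n := by
    have h := hb_tendsto.eventually ((hasDerivAt_iff_isLittleO.1 hderiv).def (half_pos hfξ))
    filter_upwards [h] with n hn
    have hρn : 0 ≤ ρ n := Real.sqrt_nonneg _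
    have hbn : b n - ξ = 2 * C / f ξ * ρ n := by simp [hb]
    rw [hbn, hFp, smul_eq_mul, Real.norm_eq_abs, Real.norm_of_nonneg (by positivity)] at hn
    convert hn using 1
    · congr 2
      field_simp
    · field_simp
  filter_upwards [hdev b] with ω hω
  simp only [log_rpow_div_rpow_eq_sqrt]
  refine Asymptotics.IsBigO.of_bound (4 * C) ?_
  filter_upwards [hω, hbF, eventually_gt_atTop 0] with n h1 h2 hn
  have h1' := abs_lt.1 h1
  have h2' := abs_le.1 h2
  have hlow := le_empDF_sampleQuantile (X := X) (ω := ω) hn hp0 hp1.le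
  have hbp : p ≤ empDF X n ω (b n) := by linarith [h1'.1, h2'.1]
  have hup := empDF_mono (X := X) (n := n) (ω := ω) (sampleQuantile_le hp0 hbp)
  rw [hFp, Real.norm_eq_abs, abs_abs, Real.norm_of_nonneg (Real.sqrt_nonneg _),
    abs_of_nonneg (sub_nonneg.2 hlow)]
  linarith [h1'.2, h2'.2]
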